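/- Suppose Assumptions A2 and A3 hold at a solution (t_b*, z_b*, λ*) of F = 0. Then the Jacobian F'(t_b*, z_b*, λ*) is an invertible (5+k)×(5+k) matrix, and consequently (t_b*, z_b*, λ*) is the unique solution of F = 0 in some neighborhood of itself (so the prior-saturation lift z_e is locally unique). -/

import Mathlib

open Set
open scoped RealInnerProductSpace

noncomputable section

/-- The plane, with its Euclidean (inner product) structure. -/
abbrev E2 : Type := EuclideanSpace ℝ (Fin 2)

/-- The cotangent bundle `ℝ² × ℝ² ≅ ℝ⁴`; `z = (x,p)`. -/
abbrev Z4 : Type := E2 × E2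

/-- Lie bracket `[f,g](x) = Dg(x)f(x) − Df(x)g(x)`. -/
def lieB (f g : E2 → E2) (x : E2) : E2 :=
  fderiv ℝ g x (f x) - fderiv ℝ f x (g x)

/-- Hamiltonian lift `H_h(z) = p·h(x)`. -/
def Hlift (h : E2 → E2) (z : Z4) : ℝ := ⟪z.2, h z.1⟫

/-- The Hamiltonian vector field of `H₊ = H_f + H_g`:
`H⃗₊(x,p) = ((f+g)(x), −(Df(x)+Dg(x))ᵀ p)`. -/
def HvecPlus (f g : E2 → E2) (z : Z4) : Z4 :=
  (f z.1 + g z.1,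
   -(ContinuousLinearMap.adjoint (fderiv ℝ f z.1 + fderiv ℝ g z.1)) z.2)

/-- The map `G(t_b,z_b,λ) = (H_g(exp(−t_b H⃗₊)(z_b)), H₊(z_b) − 1, Ψ(z_b,λ))`,
with the normal multiplier `p⁰ = −1`. -/
def Gmap (f g : E2 → E2) (Φ : ℝ → Z4 → Z4) (k : ℕ)
    (Ψ : Z4 → EuclideanSpace ℝ (Fin k) → EuclideanSpace ℝ (Fin (2+k)))
    (tb : ℝ) (zb : Z4) (lam : EuclideanSpace ℝ (Fin k)) :
    ℝ × ℝ × EuclideanSpace ℝ (Fin (2+k)) :=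
  (Hlift g (Φ (-tb) zb), Hlift (fun x => f x + g x) zb - 1, Ψ zb lam)

/-- The map `F(t_b,z_b,λ) = (H_{[f,g]}(exp(−t_b H⃗₊)(z_b)), G(t_b,z_b,λ))`. -/
def Fmap (f g : E2 → E2) (Φ : ℝ → Z4 → Z4) (k : ℕ)
    (Ψ : Z4 → EuclideanSpace ℝ (Fin k) → EuclideanSpace ℝ (Fin (2+k)))
    (tb : ℝ) (zb : Z4) (lam : EuclideanSpace ℝ (Fin k)) :
    ℝ × ℝ × ℝ × EuclideanSpace ℝ (Fin (2+k)) :=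
  (Hlift (lieB f g) (Φ (-tb) zb), Gmap f g Φ k Ψ tb zb lam)

/-- A map into `ℝ × W` on `ℝ × V` with bijective derivative, provided its derivative along the first
factor is a nonzero vertical vector and the partial derivative of its second component along `V`
is bijective. -/
theorem bijective_fderiv_of_bijective_partial {V W : Type*} [NormedAddCommGroup V]
    [NormedSpace ℝ V] [NormedAddCommGroup W] [NormedSpace ℝ W] {F : ℝ × V → ℝ × W} {t : ℝ} {w : V}
    {c : ℝ} (hF : DifferentiableAt ℝ F (t, w))
    (ht : HasDerivAt (fun s => F (s, w)) (c, 0) t) (hc : c ≠ 0)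
    (hw : Function.Bijective (fderiv ℝ (fun v => (F (t, v)).2) w)) :
    Function.Bijective (fderiv ℝ F (t, w)) := by
  have h₁ : fderiv ℝ F (t, w) (1, 0) = (c, 0) :=
    (hF.hasFDerivAt.comp_hasDerivAt t ((hasDerivAt_id t).prodMk (hasDerivAt_const t w))).unique ht
  have h₂ : ∀ v, (fderiv ℝ F (t, w) (0, v)).2 = fderiv ℝ (fun v => (F (t, v)).2) w v := by
    intro v
    have h := (hF.hasFDerivAt.comp w (hasFDerivAt_prodMk_right t w)).snd
    have h' : HasFDerivAt (fun v => (F (t, v)).2) _ w := h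
    rw [h'.fderiv]
    simp
  set L := fderiv ℝ F (t, w)
  have hL : ∀ τ v, L (τ, v) = (τ * c + (L (0, v)).1, (L (0, v)).2) := by
    intro τ v
    have : ((τ, v) : ℝ × V) = τ • (1, 0) + (0, v) := by simp
    rw [this, map_add, map_smul, h₁]
    ext <;> simp
  constructor
  · refine (injective_iff_map_eq_zero L).2 ?_
    rintro ⟨τ, v⟩ h
    rw [hL, Prod.mk_eq_zero, h₂] at h
    have hv : v = 0 := hw.1 (by rw [h.2, map_zero])
    subst hv
    have hz : L (0, 0) = 0 := map_zero L
    have hτ : τ * c = 0 := by simpa [hz] using h.1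
    simp [(mul_eq_zero.1 hτ).resolve_right hc]
  · rintro ⟨r, y⟩
    obtain ⟨v, rfl⟩ := hw.2 y
    refine ⟨((r - (L (0, v)).1) / c, v), ?_⟩
    rw [hL, h₂, div_mul_cancel₀ _ hc, sub_add_cancel]

/-- A strictly differentiable map with bijective derivative is injective near the base point. -/
theorem HasStrictFDerivAt.exists_isOpen_injOn_of_bijective {V W : Type*} [NormedAddCommGroup V]
    [NormedSpace ℝ V] [CompleteSpace V] [NormedAddCommGroup W] [NormedSpace ℝ W] [CompleteSpace W]
    {F : V → W} {L : V →L[ℝ] W} {a : V} (hF : HasStrictFDerivAt F L a)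
    (hL : Function.Bijective L) : ∃ U : Set V, IsOpen U ∧ a ∈ U ∧ InjOn F U := by
  let e : V ≃L[ℝ] W := ContinuousLinearEquiv.ofBijective L
    (LinearMap.ker_eq_bot.2 hL.1) (LinearMap.range_eq_top.2 hL.2)
  have he : HasStrictFDerivAt F (e : V →L[ℝ] W) a := by
    rwa [ContinuousLinearEquiv.coe_ofBijective]
  exact ⟨_, (he.toOpenPartialHomeomorph F).open_source, he.mem_toOpenPartialHomeomorph_source,
    (he.toOpenPartialHomeomorph F).injOn⟩

theorem ContDiff.lieB {f g : E2 → E2} (hf : ContDiff ℝ (⊤ : ℕ∞) f) (hg : ContDiff ℝ (⊤ : ℕ∞) g) :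
    ContDiff ℝ (⊤ : ℕ∞) (lieB f g) :=
  ((hg.fderiv_right (by simp)).clm_apply hf).sub ((hf.fderiv_right (by simp)).clm_apply hg)

theorem ContDiff.hlift {h : E2 → E2} (hh : ContDiff ℝ (⊤ : ℕ∞) h) :
    ContDiff ℝ (⊤ : ℕ∞) (Hlift h) :=
  contDiff_snd.inner ℝ (hh.comp contDiff_fst)

theorem hlift_lieB_self (g : E2 → E2) (z : Z4) : Hlift (lieB g g) z = 0 := by
  simp [Hlift, _root_.lieB]

/-- Along the flow of `H⃗₊`, the lift `H_h` has derivative `H_{[f,h]} + H_{[g,h]}`. -/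
theorem hasDerivAt_hlift_of_hasDerivAt {f g h : E2 → E2} (hh : Differentiable ℝ h)
    {γ : ℝ → Z4} {t : ℝ} (hγ : HasDerivAt γ (HvecPlus f g (γ t)) t) :
    HasDerivAt (fun s => Hlift h (γ s))
      (Hlift (lieB f h) (γ t) + Hlift (lieB g h) (γ t)) t := by
  have h₁ : HasDerivAt (fun s => (γ s).1) (f (γ t).1 + g (γ t).1) t := hγ.fst
  have h₂ : HasDerivAt (fun s => (γ s).2) _ t := hγ.snd
  have h₃ := (hh (γ t).1).hasFDerivAt.comp_hasDerivAt t h₁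
  refine (h₂.inner ℝ h₃).congr_deriv ?_
  simp only [HvecPlus, Hlift, lieB, Function.comp_apply, inner_neg_left,
    ContinuousLinearMap.adjoint_inner_left, add_apply, map_add, inner_add_left, inner_add_right,
    inner_sub_right]
  ring

theorem ContDiff.fmap {f g : E2 → E2} (hf : ContDiff ℝ (⊤ : ℕ∞) f) (hg : ContDiff ℝ (⊤ : ℕ∞) g)
    {k : ℕ} {Ψ : Z4 → EuclideanSpace ℝ (Fin k) → EuclideanSpace ℝ (Fin (2+k))}
    (hΨ : ContDiff ℝ (⊤ : ℕ∞) (fun q : Z4 × EuclideanSpace ℝ (Fin k) => Ψ q.1 q.2))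
    {Φ : ℝ → Z4 → Z4} (hΦ : ContDiff ℝ (⊤ : ℕ∞) (fun q : ℝ × Z4 => Φ q.1 q.2)) :
    ContDiff ℝ (⊤ : ℕ∞) (fun q : ℝ × Z4 × EuclideanSpace ℝ (Fin k) =>
      Fmap f g Φ k Ψ q.1 q.2.1 q.2.2) := by
  have hflow : ContDiff ℝ (⊤ : ℕ∞)
      (fun q : ℝ × Z4 × EuclideanSpace ℝ (Fin k) => Φ (-q.1) q.2.1) :=
    hΦ.comp (contDiff_fst.neg.prodMk contDiff_snd.fst)
  exact ((hf.lieB hg).hlift.comp hflow).prodMk ((hg.hlift.comp hflow).prodMk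
    ((((hf.add hg).hlift.comp contDiff_snd.fst).sub contDiff_const).prodMk
      (hΨ.comp contDiff_snd)))

theorem hasDerivAt_fmap {f g : E2 → E2} (hf : ContDiff ℝ (⊤ : ℕ∞) f)
    (hg : ContDiff ℝ (⊤ : ℕ∞) g) {k : ℕ}
    {Ψ : Z4 → EuclideanSpace ℝ (Fin k) → EuclideanSpace ℝ (Fin (2+k))} {Φ : ℝ → Z4 → Z4}
    (hΦ : ∀ (t : ℝ) (z : Z4), HasDerivAt (fun s => Φ s z) (HvecPlus f g (Φ t z)) t)
    (t : ℝ) (z : Z4) (lam : EuclideanSpace ℝ (Fin k)) :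
    HasDerivAt (fun s => Fmap f g Φ k Ψ s z lam)
      (-(Hlift (lieB f (lieB f g)) (Φ (-t) z) + Hlift (lieB g (lieB f g)) (Φ (-t) z)),
        -Hlift (lieB f g) (Φ (-t) z), 0, 0) t := by
  have hlift : ∀ {h : E2 → E2}, ContDiff ℝ (⊤ : ℕ∞) h →
      HasDerivAt (fun s => Hlift h (Φ (-s) z))
        (-(Hlift (lieB f h) (Φ (-t) z) + Hlift (lieB g h) (Φ (-t) z))) t := fun hh => by
    have := (hasDerivAt_hlift_of_hasDerivAt (hh.differentiable (by simp)) (hΦ (-t) z)).scomp t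
      (hasDerivAt_neg t)
    simpa only [Function.comp_def, neg_smul, one_smul] using this
  have hHg := hlift hg
  rw [hlift_lieB_self, add_zero] at hHg
  exact (hlift (hf.lieB hg)).prodMk
    (hHg.prodMk ((hasDerivAt_const t _).prodMk (hasDerivAt_const t _)))

/-- Proposition `prop:prior_lift_unique`: under Assumptions A2
and A3, the Jacobian of `F` at `(t_b*, z_b*, λ*)` is invertible (bijective),
and the solution of `F = 0` is locally unique, so the prior-saturation lift
`z_e` is locally unique. -/
theorem stmt14 (f g : E2 → E2)
    (hf : ContDiff ℝ (⊤ : ℕ∞) f) (hg : ContDiff ℝ (⊤ : ℕ∞) g)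
    (k : ℕ) (Ψ : Z4 → EuclideanSpace ℝ (Fin k) → EuclideanSpace ℝ (Fin (2+k)))
    (hΨ : ContDiff ℝ (⊤ : ℕ∞) (fun q : Z4 × EuclideanSpace ℝ (Fin k) => Ψ q.1 q.2))
    -- the complete flow Φ of H⃗₊
    (Φ : ℝ → Z4 → Z4)
    (hΦsmooth : ContDiff ℝ (⊤ : ℕ∞) (fun q : ℝ × Z4 => Φ q.1 q.2))
    (hΦ0 : ∀ z : Z4, Φ 0 z = z)
    (hΦd : ∀ (t : ℝ) (z : Z4), HasDerivAt (fun s => Φ s z) (HvecPlus f g (Φ t z)) t)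
    -- the solution of F = 0 and the point z_e
    (tbs : ℝ) (zbs : Z4) (lams : EuclideanSpace ℝ (Fin k))
    (hsol : Fmap f g Φ k Ψ tbs zbs lams = 0)
    (ze : Z4) (hze : ze = Φ (-tbs) zbs)
    -- Assumption A2
    (hA2 : Hlift (lieB g (lieB f g)) ze ≠ 0 ∧
      -Hlift (lieB f (lieB f g)) ze / Hlift (lieB g (lieB f g)) ze < 1)
    -- Assumption A3
    (hA3 : Function.Bijective
      (fderiv ℝ (fun q : Z4 × EuclideanSpace ℝ (Fin k) =>
        Gmap f g Φ k Ψ tbs q.1 q.2) (zbs, lams))) :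
    Function.Bijective
      (fderiv ℝ (fun q : ℝ × Z4 × EuclideanSpace ℝ (Fin k) =>
        Fmap f g Φ k Ψ q.1 q.2.1 q.2.2) (tbs, zbs, lams)) ∧
    ∃ U : Set (ℝ × Z4 × EuclideanSpace ℝ (Fin k)), IsOpen U ∧
      (tbs, zbs, lams) ∈ U ∧
      ∀ q ∈ U, Fmap f g Φ k Ψ q.1 q.2.1 q.2.2 = 0 → q = (tbs, zbs, lams) := by
  subst hze
  have hF := hf.fmap hg hΨ hΦsmooth
  have hbij : Function.Bijective
      (fderiv ℝ (fun q : ℝ × Z4 × EuclideanSpace ℝ (Fin k) =>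
        Fmap f g Φ k Ψ q.1 q.2.1 q.2.2) (tbs, zbs, lams)) := by
    have hfg : Hlift (lieB f g) (Φ (-tbs) zbs) = 0 := congrArg Prod.fst hsol
    have hd := hasDerivAt_fmap (Ψ := Ψ) hf hg hΦd tbs zbs lams
    rw [hfg, neg_zero] at hd
    refine bijective_fderiv_of_bijective_partial
      (hF.differentiable (by simp)).differentiableAt hd (neg_ne_zero.2 fun h => ?_) hA3
    have h' := hA2.2
    rw [neg_eq_of_add_eq_zero_right h, div_self hA2.1] at h'
    exact lt_irrefl _ h'
  obtain ⟨U, hU, hmem, hinj⟩ :=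
    (hF.contDiffAt.hasStrictFDerivAt (by simp)).exists_isOpen_injOn_of_bijective hbij
  exact ⟨hbij, U, hU, hmem, fun q hq h => hinj hq hmem (h.trans hsol.symm)⟩
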